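/- For every infinite set X, the ring R_X is a Noetherian integral domain of cardinality |X| whose additive group is a free abelian group; consequently, for every infinite cardinal κ there is a Noetherian domain of cardinality κ with free additive group. -/

import Mathlib

set_option synthInstance.maxHeartbeats 1000000
set_option maxHeartbeats 1000000

/-- A multivariate integer polynomial is primitive if it is not divisible by any
integer `m > 1`. -/
def MvPrimitive {X : Type*} (q : MvPolynomial X ℤ) : Prop :=
  ∀ m : ℤ, 1 < m → ¬ (MvPolynomial.C m ∣ q)

/-- `ℚ(X)`, the field of fractions of `ℤ[X]`. -/
abbrev FracField (X : Type*) := FractionRing (MvPolynomial X ℤ)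

/-- The set of elements `p / q` of `ℚ(X)` with `p, q ∈ ℤ[X]` polynomials in the
variables from `Z` and `q` primitive. -/
def Rset (X : Type*) (Z : Set X) : Set (FracField X) :=
  {x | ∃ p q : MvPolynomial X ℤ,
      p ∈ MvPolynomial.supported ℤ Z ∧ q ∈ MvPolynomial.supported ℤ Z ∧
      MvPrimitive q ∧
      x = algebraMap (MvPolynomial X ℤ) (FracField X) p /
          algebraMap (MvPolynomial X ℤ) (FracField X) q}

/-- `R_Z` as a subring of `ℚ(X)`; since the set `Rset X Z` is closed under the ring
operations (by Gauss's lemma), this subring is exactly `Rset X Z`. -/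
noncomputable def Rsub (X : Type*) (Z : Set X) : Subring (FracField X) :=
  Subring.closure (Rset X Z)

/-- `R⁺_Z`, the additive group of `R_Z`, as an additive subgroup of `ℚ(X)`;
since the set `Rset X Z` is closed under addition and negation (by Gauss's lemma),
this additive subgroup is exactly `Rset X Z`. -/
noncomputable def Radd (X : Type*) (Z : Set X) : AddSubgroup (FracField X) :=
  AddSubgroup.closure (Rset X Z)

theorem free_of_filtration {ι : Type*} [LinearOrder ι] [WellFoundedLT ι] {M : Type*}
    [AddCommGroup M] (F : ι → Submodule ℤ M) (hmono : Monotone F)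
    (hcov : ∀ x : M, x = 0 ∨ ∃ i, x ∈ F i)
    {N : ι → Type*} [∀ i, AddCommGroup (N i)]
    (φ : ∀ i, F i →ₗ[ℤ] N i)
    (hfree : ∀ i, Module.Free ℤ (LinearMap.range (φ i)))
    (hker : ∀ i (x : F i), φ i x = 0 → (x : M) = 0 ∨ ∃ j, j < i ∧ (x : M) ∈ F j)
    (hker' : ∀ i j (x : F i), j < i → (x : M) ∈ F j → φ i x = 0) :
    Module.Free ℤ M := by
  classical
  have hs : ∀ i, ∃ s : LinearMap.range (φ i) →ₗ[ℤ] F i, ∀ y, φ i (s y) = y := by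
    intro i
    have := hfree i
    obtain ⟨s, hs⟩ := Module.projective_lifting_property (φ i).rangeRestrict LinearMap.id
      (φ i).surjective_rangeRestrict
    refine ⟨s, fun y => ?_⟩
    have := congrArg Subtype.val (LinearMap.congr_fun hs y)
    simpa using this
  choose s hs using hs
  let Φ : (DirectSum ι fun i => LinearMap.range (φ i)) →ₗ[ℤ] M :=
    DirectSum.toModule ℤ ι M (fun i => (F i).subtype ∘ₗ s i)
  have hΦof : ∀ i y, Φ (DirectSum.lof ℤ ι (fun i => LinearMap.range (φ i)) i y) = s i y := by
    intro i y
    simp [Φ]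
  have hinj : Function.Injective Φ := by
    rw [← LinearMap.ker_eq_bot, LinearMap.ker_eq_bot']
    intro u hu
    by_contra hne
    have hsupp : (DFinsupp.support u).Nonempty := by
      rw [Finset.nonempty_iff_ne_empty]
      intro h
      exact hne (DFinsupp.support_eq_empty.mp h)
    set i := (DFinsupp.support u).max' hsupp with hi
    have himem : i ∈ DFinsupp.support u := Finset.max'_mem _ _
    have hle : ∀ j ∈ DFinsupp.support u, j ≤ i := fun j hj => Finset.le_max' _ _ hj
    have hsum : Φ u = ∑ j ∈ DFinsupp.support u, (s j (u j) : M) := by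
      conv_lhs => rw [← DirectSum.sum_support_of u]
      rw [map_sum]
      refine Finset.sum_congr rfl fun j _ => ?_
      exact hΦof j (u j)
    let t : ι → F i := fun j => if h : j ≤ i then ⟨s j (u j), hmono h (s j (u j)).2⟩ else 0
    have ht : ∑ j ∈ DFinsupp.support u, t j = 0 := by
      apply Subtype.ext
      rw [Submodule.coe_sum]
      rw [Submodule.coe_zero, ← hu, hsum]
      refine Finset.sum_congr rfl fun j hj => ?_
      simp [t, hle j hj]
    have h0 := congrArg (φ i) ht
    rw [map_sum, map_zero, Finset.sum_eq_single i] at h0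
    · have : t i = s i (u i) := by simp [t]
      rw [this, hs] at h0
      exact (DFinsupp.mem_support_iff.mp himem) (Subtype.ext h0)
    · intro j hj hji
      apply hker' i j _ (lt_of_le_of_ne (hle j hj) hji)
      simp [t, hle j hj]
    · exact fun h => absurd himem h
  have hsurj : Function.Surjective Φ := by
    have key : ∀ i, ∀ x ∈ F i, x ∈ LinearMap.range Φ := by
      intro i
      induction i using WellFoundedLT.induction with
      | ind i ih =>
        intro x hx
        have h1 : φ i (⟨x, hx⟩ - s i ⟨φ i ⟨x, hx⟩, LinearMap.mem_range_self _ _⟩) = 0 := by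
          rw [map_sub, hs, sub_self]
        have h2 : ((⟨x, hx⟩ - s i ⟨φ i ⟨x, hx⟩, LinearMap.mem_range_self _ _⟩ : F i) : M)
            ∈ LinearMap.range Φ := by
          rcases hker i _ h1 with h | ⟨j, hj, h⟩
          · rw [h]; exact Submodule.zero_mem _
          · exact ih j hj _ h
        have h3 : ((s i ⟨φ i ⟨x, hx⟩, LinearMap.mem_range_self _ _⟩ : F i) : M)
            ∈ LinearMap.range Φ := ⟨_, hΦof i _⟩
        simpa using Submodule.add_mem _ h2 h3
    intro x
    rcases hcov x with rfl | ⟨i, hi⟩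
    · exact ⟨0, map_zero _⟩
    · exact key i x hi
  exact Module.Free.of_equiv (LinearEquiv.ofBijective Φ ⟨hinj, hsurj⟩)

theorem free_submodule_int {N : Type*} [AddCommGroup N] [Module.Free ℤ N]
    (K : Submodule ℤ N) : Module.Free ℤ K := by
  classical
  let b := Module.Free.chooseBasis ℤ N
  let ι := Module.Free.ChooseBasisIndex ℤ N
  obtain ⟨_, _⟩ := exists_wellFoundedLT ι
  let F : ι → Submodule ℤ K := fun i =>
    { carrier := {x | ∀ j, i < j → b.repr (x : N) j = 0}
      add_mem' := by
        intro x y hx hy j hj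
        simp [hx j hj, hy j hj]
      zero_mem' := by intro j hj; simp
      smul_mem' := by
        intro c x hx j hj
        simp [hx j hj] }
  refine free_of_filtration F ?_ ?_ (N := fun _ => ℤ)
    (fun i => b.coord i ∘ₗ K.subtype ∘ₗ (F i).subtype) (fun i => inferInstance) ?_ ?_
  · intro i j hij x hx k hk
    exact hx k (lt_of_le_of_lt hij hk)
  · intro x
    by_cases hx : x = 0
    · exact Or.inl hx
    right
    have hne : (b.repr (x : N)).support.Nonempty := by
      rw [Finsupp.support_nonempty_iff]
      simpa using hx
    refine ⟨(b.repr (x : N)).support.max' hne, fun j hj => ?_⟩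
    · by_contra h
      exact absurd (Finset.le_max' _ _ (Finsupp.mem_support_iff.mpr h)) (not_le.mpr hj)
  · intro i x hx
    by_cases hx0 : (x : K) = 0
    · exact Or.inl hx0
    right
    have hne : (b.repr ((x : K) : N)).support.Nonempty := by
      rw [Finsupp.support_nonempty_iff]
      simpa using hx0
    refine ⟨(b.repr ((x : K) : N)).support.max' hne, ?_, fun j hj => ?_⟩
    · have hm := Finset.max'_mem _ hne
      have hm' := Finsupp.mem_support_iff.mp hm
      rcases lt_trichotomy ((b.repr ((x : K) : N)).support.max' hne) i with h | h | h
      · exact h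
      · rw [h] at hm'; exact absurd hx hm'
      · exact absurd (x.2 _ h) hm'
    · by_contra h
      exact absurd (Finset.le_max' _ _ (Finsupp.mem_support_iff.mpr h)) (not_le.mpr hj)
  · intro i j x hji hx
    exact hx i hji

/-- Pontryagin-type criterion. -/
theorem free_of_countable {M : Type*} [AddCommGroup M] [Countable M]
    [Module.IsTorsionFree ℤ M]
    (h : ∀ N : Submodule ℤ M, N.FG → ∃ P : Submodule ℤ M, P.FG ∧
      ∀ x : M, ∀ m : ℤ, m ≠ 0 → m • x ∈ N → x ∈ P) : Module.Free ℤ M := by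
  classical
  let cl : Submodule ℤ M → Submodule ℤ M := fun N =>
    { carrier := {x | ∃ m : ℤ, m ≠ 0 ∧ m • x ∈ N}
      add_mem' := by
        rintro x y ⟨m, hm, hx⟩ ⟨n, hn, hy⟩
        refine ⟨m * n, mul_ne_zero hm hn, ?_⟩
        have : (m * n) • (x + y) = n • (m • x) + m • (n • y) := by
          rw [smul_add, smul_smul, smul_smul, mul_comm n m]
        rw [this]
        exact N.add_mem (N.smul_mem _ hx) (N.smul_mem _ hy)
      zero_mem' := ⟨1, one_ne_zero, by simp⟩
      smul_mem' := by
        rintro c x ⟨m, hm, hx⟩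
        exact ⟨m, hm, by rw [smul_comm]; exact N.smul_mem _ hx⟩ }
  have hclfg : ∀ N : Submodule ℤ M, N.FG → (cl N).FG := by
    intro N hN
    obtain ⟨P, hP, hPx⟩ := h N hN
    have : cl N ≤ P := by
      rintro x ⟨m, hm, hx⟩
      exact hPx x m hm hx
    have : IsNoetherian ℤ P := isNoetherian_of_fg_of_noetherian P hP
    exact Submodule.FG.of_le hP ‹_›
  obtain ⟨e, he⟩ := exists_surjective_nat M
  let S : ℕ → Submodule ℤ M := fun n => Submodule.span ℤ (e '' Set.Iio n)
  let F : ℕ → Submodule ℤ M := fun n => cl (S n)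
  have hmono : Monotone F := by
    rintro i j hij x ⟨m, hm, hx⟩
    exact ⟨m, hm, Submodule.span_mono (Set.image_mono (Set.Iio_subset_Iio hij)) hx⟩
  have hsat : ∀ n (m : ℤ) x, m ≠ 0 → m • x ∈ F n → x ∈ F n := by
    rintro n m x hm ⟨k, hk, hx⟩
    exact ⟨k * m, mul_ne_zero hk hm, by rwa [mul_smul]⟩
  refine free_of_filtration F hmono ?_
    (N := fun n => F n ⧸ (F (n - 1)).comap (F n).subtype)
    (fun n => Submodule.mkQ _) ?_ ?_ ?_
  · intro x
    right
    obtain ⟨n, rfl⟩ := he x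
    exact ⟨n + 1, 1, one_ne_zero, by
      rw [one_smul]; exact Submodule.subset_span ⟨n, by simp, rfl⟩⟩
  · intro n
    have h1 : Module.Finite ℤ (F n) :=
      Module.Finite.iff_fg.mpr (hclfg _ (Submodule.fg_span ((Set.finite_Iio n).image e)))
    have h2 : Module.IsTorsionFree ℤ (F n ⧸ (F (n - 1)).comap (F n).subtype) := by
      refine Module.IsTorsionFree.of_smul_eq_zero fun m y hy => ?_
      obtain ⟨y, rfl⟩ := Submodule.mkQ_surjective _ y
      by_cases hm : m = 0
      · exact Or.inl hm
      right
      rw [← map_smul, Submodule.mkQ_apply, Submodule.Quotient.mk_eq_zero] at hy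
      rw [Submodule.mkQ_apply, Submodule.Quotient.mk_eq_zero]
      exact hsat _ m _ hm hy
    have h3 : Module.Free ℤ (F n ⧸ (F (n - 1)).comap (F n).subtype) := inferInstance
    exact free_submodule_int _
  · intro n x hx
    rw [Submodule.mkQ_apply, Submodule.Quotient.mk_eq_zero] at hx
    rcases n with _ | n
    · left
      obtain ⟨m, hm, hx⟩ := x.2
      have hS : S 0 = ⊥ := by simp [S]
      rw [hS, Submodule.mem_bot] at hx
      exact (smul_eq_zero.mp hx).resolve_left hm
    · right
      exact ⟨n, by simp, hx⟩
  · intro n j x hj hx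
    rw [Submodule.mkQ_apply, Submodule.Quotient.mk_eq_zero]
    exact hmono (by omega : j ≤ n - 1) hx

section Prim
variable {X : Type*}

theorem prim_not_prime_dvd {q : MvPolynomial X ℤ} (hq : MvPrimitive q) {p : ℤ} (hp : Prime p) :
    ¬ (MvPolynomial.C p ∣ q) := by
  intro h
  have h1 : 1 < |p| := by
    have := (Int.prime_iff_natAbs_prime.mp hp).one_lt
    rw [Int.abs_eq_natAbs]; exact_mod_cast this
  refine hq _ h1 (dvd_trans ?_ h)
  exact map_dvd MvPolynomial.C ((abs_dvd p p).mpr dvd_rfl)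

theorem prim_of_not_prime_dvd {q : MvPolynomial X ℤ}
    (h : ∀ p : ℤ, Prime p → ¬ (MvPolynomial.C p ∣ q)) : MvPrimitive q := by
  intro m hm hd
  have hm' : m.natAbs ≠ 1 := by omega
  obtain ⟨p, hp, hpm⟩ := Int.exists_prime_and_dvd hm'
  exact h p hp (dvd_trans (map_dvd MvPolynomial.C hpm) hd)

theorem prim_mul {a b : MvPolynomial X ℤ} (ha : MvPrimitive a) (hb : MvPrimitive b) :
    MvPrimitive (a * b) := by
  apply prim_of_not_prime_dvd
  intro p hp hd
  rcases ((MvPolynomial.prime_C_iff X).mpr hp).dvd_or_dvd hd with h | h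
  · exact prim_not_prime_dvd ha hp h
  · exact prim_not_prime_dvd hb hp h

theorem prim_one : MvPrimitive (1 : MvPolynomial X ℤ) := by
  apply prim_of_not_prime_dvd
  intro p hp hd
  exact ((MvPolynomial.prime_C_iff X).mpr hp).not_isUnit (isUnit_of_dvd_one hd)

theorem prim_ne_zero {a : MvPolynomial X ℤ} (ha : MvPrimitive a) : a ≠ 0 := by
  rintro rfl
  exact ha 2 (by norm_num) (dvd_zero _)

theorem prim_alg_ne_zero {a : MvPolynomial X ℤ} (ha : MvPrimitive a) :
    algebraMap (MvPolynomial X ℤ) (FracField X) a ≠ 0 := by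
  simpa using prim_ne_zero ha

theorem prim_dvd {b : MvPolynomial X ℤ} (hb : MvPrimitive b) (m : ℤ) :
    ∀ g : MvPolynomial X ℤ, MvPolynomial.C m ∣ b * g → MvPolynomial.C m ∣ g := by
  induction m using UniqueFactorizationMonoid.induction_on_prime with
  | h₁ =>
    intro g h
    rw [map_zero, zero_dvd_iff] at h ⊢
    exact (mul_eq_zero.mp h).resolve_left (prim_ne_zero hb)
  | h₂ x hx =>
    intro g _
    exact (hx.map MvPolynomial.C).dvd
  | h₃ a p _ hp ih =>
    intro g h
    rw [map_mul] at h ⊢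
    have h1 := dvd_trans (dvd_mul_right _ _) h
    obtain ⟨g', rfl⟩ := (((MvPolynomial.prime_C_iff X).mpr hp).dvd_or_dvd h1).resolve_left
      (prim_not_prime_dvd hb hp)
    rw [mul_left_comm] at h
    have hp0 : (MvPolynomial.C p : MvPolynomial X ℤ) ≠ 0 :=
      ((MvPolynomial.prime_C_iff X).mpr hp).ne_zero
    exact mul_dvd_mul_left _ (ih g' ((mul_dvd_mul_iff_left hp0).mp h))

theorem exists_content (p : MvPolynomial X ℤ) :
    ∃ (c : ℤ) (p' : MvPolynomial X ℤ), MvPrimitive p' ∧ p = MvPolynomial.C c * p' := by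
  by_cases hp : p = 0
  · exact ⟨0, 1, prim_one, by simp [hp]⟩
  obtain ⟨d, hd⟩ := MvPolynomial.ne_zero_iff.mp hp
  have key : ∀ n : ℕ, ∀ p : MvPolynomial X ℤ, (p.coeff d).natAbs = n → p.coeff d ≠ 0 →
      ∃ (c : ℤ) (p' : MvPolynomial X ℤ), MvPrimitive p' ∧ p = MvPolynomial.C c * p' := by
    intro n
    induction n using Nat.strong_induction_on with
    | _ n ih =>
      intro p hn hd
      by_cases hprim : MvPrimitive p
      · exact ⟨1, p, hprim, by simp⟩
      unfold MvPrimitive at hprim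
      push Not at hprim
      obtain ⟨m, hm, g, rfl⟩ := hprim
      rw [MvPolynomial.coeff_C_mul] at hn hd
      have hg : g.coeff d ≠ 0 := right_ne_zero_of_mul hd
      have : (g.coeff d).natAbs < n := by
        rw [← hn, Int.natAbs_mul]
        have h1 : 0 < (g.coeff d).natAbs := Int.natAbs_pos.mpr hg
        have h2 : 1 < m.natAbs := by omega
        nlinarith
      obtain ⟨c, p', hp', h⟩ := ih _ this g rfl hg
      exact ⟨m * c, p', hp', by rw [h, map_mul, mul_assoc, ← h]⟩
  exact key _ p rfl hd

theorem prim_rename {q : MvPolynomial X ℤ} (hq : MvPrimitive q) (e : Equiv.Perm X) :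
    MvPrimitive (MvPolynomial.rename e q) := by
  intro m hm h
  apply hq m hm
  have := map_dvd (MvPolynomial.rename (R := ℤ) e.symm) h
  simpa [MvPolynomial.rename_rename] using this

/-- The set `Rset X Z` as a subring. -/
noncomputable def Rr (X : Type*) (Z : Set X) : Subring (FracField X) where
  carrier := Rset X Z
  mul_mem' := by
    rintro _ _ ⟨p, q, hp, hq, hpr, rfl⟩ ⟨p', q', hp', hq', hpr', rfl⟩
    refine ⟨p * p', q * q', mul_mem hp hp', mul_mem hq hq', prim_mul hpr hpr', ?_⟩
    rw [map_mul, map_mul, div_mul_div_comm]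
  one_mem' := ⟨1, 1, one_mem _, one_mem _, prim_one, by simp⟩
  add_mem' := by
    rintro _ _ ⟨p, q, hp, hq, hpr, rfl⟩ ⟨p', q', hp', hq', hpr', rfl⟩
    refine ⟨p * q' + q * p', q * q', add_mem (mul_mem hp hq') (mul_mem hq hp'), mul_mem hq hq',
      prim_mul hpr hpr', ?_⟩
    rw [map_add, map_mul, map_mul, map_mul,
      div_add_div _ _ (prim_alg_ne_zero hpr) (prim_alg_ne_zero hpr')]
  zero_mem' := ⟨0, 1, zero_mem _, one_mem _, prim_one, by simp⟩
  neg_mem' := by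
    rintro _ ⟨p, q, hp, hq, hpr, rfl⟩
    exact ⟨-p, q, neg_mem hp, hq, hpr, by rw [map_neg, neg_div]⟩

theorem Rsub_eq (Z : Set X) : Rsub X Z = Rr X Z := Subring.closure_eq (Rr X Z)

/-- The additive group of `Rr X Z` as a `ℤ`-submodule. -/
noncomputable def Rm (X : Type*) (Z : Set X) : Submodule ℤ (FracField X) :=
  AddSubgroup.toIntSubmodule (Rr X Z).toAddSubgroup

theorem mem_Rm {Z : Set X} {x : FracField X} : x ∈ Rm X Z ↔ x ∈ Rset X Z := Iff.rfl

theorem Rm_mono {Z W : Set X} (h : Z ⊆ W) : Rm X Z ≤ Rm X W := by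
  rintro _ ⟨p, q, hp, hq, hpr, rfl⟩
  exact ⟨p, q, MvPolynomial.supported_mono h hp, MvPolynomial.supported_mono h hq, hpr, rfl⟩

/-- The automorphism of the fraction field induced by a permutation of the variables. -/
noncomputable def Tm (e : Equiv.Perm X) : FracField X ≃+* FracField X :=
  IsFractionRing.ringEquivOfRingEquiv (MvPolynomial.renameEquiv ℤ e).toRingEquiv

theorem Tm_div (e : Equiv.Perm X) (p q : MvPolynomial X ℤ) :
    Tm e (algebraMap (MvPolynomial X ℤ) (FracField X) p /
          algebraMap (MvPolynomial X ℤ) (FracField X) q) =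
      algebraMap (MvPolynomial X ℤ) (FracField X) (MvPolynomial.rename e p) /
          algebraMap (MvPolynomial X ℤ) (FracField X) (MvPolynomial.rename e q) := by
  rw [map_div₀]
  unfold Tm
  rw [IsFractionRing.ringEquivOfRingEquiv_algebraMap,
    IsFractionRing.ringEquivOfRingEquiv_algebraMap]
  rfl

theorem rename_mem {e : X → X} {p : MvPolynomial X ℤ} {W : Set X}
    (h : ∀ v ∈ p.vars, e v ∈ W) :
    MvPolynomial.rename e p ∈ MvPolynomial.supported ℤ W := by
  classical
  rw [MvPolynomial.mem_supported]
  intro v hv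
  have := MvPolynomial.vars_rename e p hv
  rw [Finset.mem_image] at this
  obtain ⟨u, hu, rfl⟩ := this
  exact h u hu

theorem rename_fix {e : X → X} {p : MvPolynomial X ℤ} 
    (h : ∀ v ∈ p.vars, e v = v) : MvPolynomial.rename e p = p := by
  have : MvPolynomial.rename e p = MvPolynomial.rename id p := by
    rw [MvPolynomial.rename_eq_aeval, MvPolynomial.rename_eq_aeval]
    change MvPolynomial.eval₂Hom _ _ p = MvPolynomial.eval₂Hom _ _ p
    apply MvPolynomial.eval₂Hom_congr' rfl _ rfl
    intro i hi _
    simp [h i hi]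
  rw [this, MvPolynomial.rename_id_apply]

theorem Tm_mem {e : Equiv.Perm X} {Z W : Set X} (h : ∀ z ∈ Z, e z ∈ W) {f : FracField X}
    (hf : f ∈ Rm X Z) : Tm e f ∈ Rm X W := by
  obtain ⟨p, q, hp, hq, hpr, rfl⟩ := hf
  rw [MvPolynomial.mem_supported] at hp hq
  rw [Tm_div]
  exact ⟨_, _, rename_mem fun v hv => h v (hp hv), rename_mem fun v hv => h v (hq hv),
    prim_rename hpr e, rfl⟩

theorem Tm_fix {e : Equiv.Perm X} {Z : Set X} (h : ∀ z ∈ Z, e z = z) {f : FracField X}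
    (hf : f ∈ Rm X Z) : Tm e f = f := by
  obtain ⟨p, q, hp, hq, hpr, rfl⟩ := hf
  rw [MvPolynomial.mem_supported] at hp hq
  rw [Tm_div, rename_fix fun v hv => h v (hp hv), rename_fix fun v hv => h v (hq hv)]

theorem Tm_ker [DecidableEq X] {W : Set X} (hW : W.Infinite) {z y : X} (hz : z ∉ W) (hy : y ∉ W)
    (hzy : y ≠ z) {f : FracField X} (hf : f ∈ Rm X (insert z W))
    (h : Tm (Equiv.swap z y) f = f) : f ∈ Rm X W := by
  obtain ⟨p, q, hp, hq, hpr, rfl⟩ := hf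
  rw [MvPolynomial.mem_supported] at hp hq
  obtain ⟨w, hwW, hw⟩ := hW.exists_notMem_finset (p.vars ∪ q.vars)
  have hwy : w ≠ y := fun h => hy (h ▸ hwW)
  have hwz : w ≠ z := fun h => hz (h ▸ hwW)
  rw [Finset.notMem_union] at hw
  have aux : ∀ p : MvPolynomial X ℤ, ↑p.vars ⊆ insert z W → w ∉ p.vars →
      MvPolynomial.rename (Equiv.swap y w) p = p ∧
      MvPolynomial.rename (Equiv.swap y w) (MvPolynomial.rename (Equiv.swap z y) p) ∈
        MvPolynomial.supported ℤ W := by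
    intro p hp hw
    constructor
    · apply rename_fix
      intro v hv
      apply Equiv.swap_apply_of_ne_of_ne
      · rintro rfl
        rcases hp hv with h | h
        · exact hzy h
        · exact hy h
      · rintro rfl; exact hw hv
    · rw [MvPolynomial.rename_rename]
      apply rename_mem
      intro v hv
      rcases hp hv with rfl | h
      · simpa using hwW
      · have h1 : v ≠ z := fun e => hz (e ▸ h)
        have h2 : v ≠ y := fun e => hy (e ▸ h)
        have h3 : v ≠ w := fun e => hw (e ▸ hv)
        simpa [Equiv.swap_apply_of_ne_of_ne, h1, h2, h3] using h
  obtain ⟨h1, h2⟩ := aux p hp hw.1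
  obtain ⟨h3, h4⟩ := aux q hq hw.2
  have h5 := congrArg (Tm (Equiv.swap y w)) h
  rw [Tm_div, Tm_div, Tm_div, h1, h3] at h5
  exact ⟨_, _, h2, h4, prim_rename (prim_rename hpr _) _, h5.symm⟩

theorem countable_supported {Z : Set X} (hZ : Z.Countable) :
    Countable (MvPolynomial.supported ℤ Z) := by
  have := hZ.to_subtype
  have h : Countable (MvPolynomial Z ℤ) := by
    rw [← Cardinal.mk_le_aleph0_iff]
    refine MvPolynomial.cardinalMk_le_max_lift.trans ?_
    simp
  exact (MvPolynomial.supportedEquivMvPolynomial (R := ℤ) Z).toEquiv.countable_iff.mpr h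

theorem countable_Rm {Z : Set X} (hZ : Z.Countable) : Countable (Rm X Z) := by
  have := countable_supported hZ
  have hc : (Rset X Z).Countable := by
    refine Set.Countable.mono ?_ (Set.countable_range
      (fun a : MvPolynomial.supported ℤ Z × MvPolynomial.supported ℤ Z =>
        algebraMap (MvPolynomial X ℤ) (FracField X) a.1 /
          algebraMap (MvPolynomial X ℤ) (FracField X) a.2))
    rintro _ ⟨p, q, hp, hq, hpr, rfl⟩
    exact ⟨(⟨p, hp⟩, ⟨q, hq⟩), rfl⟩
  exact hc.to_subtype

theorem common_denom (Z : Set X) (s : Finset (Rm X Z)) :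
    ∃ q : MvPolynomial X ℤ, MvPrimitive q ∧ ∀ h ∈ s, ∃ g : MvPolynomial X ℤ,
      algebraMap (MvPolynomial X ℤ) (FracField X) g =
        algebraMap (MvPolynomial X ℤ) (FracField X) q * (h : FracField X) := by
  classical
  induction s using Finset.induction_on with
  | empty => exact ⟨1, prim_one, by simp⟩
  | insert a s _ ih =>
    obtain ⟨q, hq, hs⟩ := ih
    obtain ⟨p, r, hp, hr, hpr, ha⟩ := a.2
    refine ⟨q * r, prim_mul hq hpr, ?_⟩
    intro h hh
    rw [Finset.mem_insert] at hh
    rcases hh with rfl | hh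
    · refine ⟨q * p, ?_⟩
      have := prim_alg_ne_zero hpr
      rw [ha, map_mul, map_mul]
      field_simp
    · obtain ⟨g, hg⟩ := hs h hh
      refine ⟨g * r, ?_⟩
      rw [map_mul, map_mul, hg]
      ring

instance torsionFree_frac : Module.IsTorsionFree ℤ (FracField X) := by
  have : CharZero (FracField X) := 
    charZero_of_injective_algebraMap (IsFractionRing.injective (MvPolynomial X ℤ) (FracField X))
  infer_instance

theorem free_Rm_countable {Z : Set X} (hZ : Z.Countable) : Module.Free ℤ (Rm X Z) := by
  classical
  have := countable_Rm hZ
  apply free_of_countable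
  rintro _ ⟨s, rfl⟩
  obtain ⟨q, hq, hs⟩ := common_denom Z s
  choose! g hg using hs
  let D : Finset (X →₀ ℕ) := s.biUnion fun h => (g h).support
  have hN : ∀ x ∈ Submodule.span ℤ (s : Set (Rm X Z)), ∃ g : MvPolynomial X ℤ,
      g.support ⊆ D ∧ algebraMap (MvPolynomial X ℤ) (FracField X) g =
        algebraMap (MvPolynomial X ℤ) (FracField X) q * (x : FracField X) := by
    intro x hx
    induction hx using Submodule.span_induction with
    | mem x hx => exact ⟨g x, Finset.subset_biUnion_of_mem (fun h => (g h).support) hx, hg x hx⟩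
    | zero => exact ⟨0, by simp, by simp⟩
    | add x y _ _ hx hy =>
      obtain ⟨a, ha, ha'⟩ := hx
      obtain ⟨b, hb, hb'⟩ := hy
      refine ⟨a + b, MvPolynomial.support_add.trans (Finset.union_subset ha hb), ?_⟩
      rw [map_add, ha', hb', Submodule.coe_add, mul_add]
    | smul c x _ hx =>
      obtain ⟨a, ha, ha'⟩ := hx
      refine ⟨c • a, MvPolynomial.support_smul.trans ha, ?_⟩
      rw [map_zsmul, ha', Submodule.coe_smul, mul_smul_comm]
  let Y : Submodule ℤ (FracField X) := Submodule.span ℤ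
    ((fun d => algebraMap (MvPolynomial X ℤ) (FracField X) (MvPolynomial.monomial d 1)) '' D)
  have hYfg : Y.FG := Submodule.fg_span (D.finite_toSet.image _)
  have hY : ∀ g : MvPolynomial X ℤ, g.support ⊆ D →
      algebraMap (MvPolynomial X ℤ) (FracField X) g ∈ Y := by
    intro g hgD
    rw [g.as_sum, map_sum]
    refine Submodule.sum_mem _ fun d hd => ?_
    have : MvPolynomial.monomial d (g.coeff d) = g.coeff d • MvPolynomial.monomial d (1 : ℤ) := by
      rw [MvPolynomial.smul_monomial]; simp
    rw [this, map_zsmul]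
    exact Submodule.smul_mem _ _ (Submodule.subset_span ⟨d, hgD hd, rfl⟩)
  let L : Rm X Z →ₗ[ℤ] FracField X :=
    (LinearMap.mulLeft ℤ (algebraMap (MvPolynomial X ℤ) (FracField X) q)) ∘ₗ (Rm X Z).subtype
  have hL : Function.Injective L := by
    intro a b hab
    exact Subtype.ext (mul_left_cancel₀ (prim_alg_ne_zero hq) hab)
  refine ⟨Y.comap L, ?_, ?_⟩
  · apply Submodule.fg_of_fg_map_injective L hL
    have : IsNoetherian ℤ Y := isNoetherian_of_fg_of_noetherian Y hYfg
    exact Submodule.FG.of_le hYfg (Submodule.map_comap_le _ _)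
  · intro x m hm hx
    obtain ⟨g, hgD, hg⟩ := hN _ hx
    obtain ⟨a, b, ha, hb, hbpr, hxab⟩ := x.2
    have hb0 := prim_alg_ne_zero hbpr
    have e1 : b * g = MvPolynomial.C m * (q * a) := by
      apply IsFractionRing.injective (MvPolynomial X ℤ) (FracField X)
      rw [map_mul, map_mul, map_mul, hg, Submodule.coe_smul, hxab, zsmul_eq_mul]
      have : algebraMap (MvPolynomial X ℤ) (FracField X) (MvPolynomial.C m) = (m : FracField X) := by
        simp
      rw [this]
      field_simp
    obtain ⟨g', rfl⟩ := prim_dvd hbpr m g ⟨_, e1⟩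
    have hs' : g'.support ⊆ D := by
      refine subset_trans ?_ hgD
      intro d hd
      rw [MvPolynomial.mem_support_iff] at hd ⊢
      rw [MvPolynomial.coeff_C_mul]
      exact mul_ne_zero hm hd
    have hC : (MvPolynomial.C m : MvPolynomial X ℤ) ≠ 0 := by simpa using hm
    have e2 : b * g' = q * a := by
      apply mul_left_cancel₀ hC
      rw [← e1]; ring
    have e3 : L x = algebraMap (MvPolynomial X ℤ) (FracField X) g' := by
      change algebraMap (MvPolynomial X ℤ) (FracField X) q * (x : FracField X) = _
      rw [hxab, ← mul_div_assoc, div_eq_iff hb0, ← map_mul, ← map_mul, ← e2, mul_comm]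
    rw [Submodule.mem_comap, e3]
    exact hY _ hs'

end Prim
section Main

theorem free_of_le {M : Type*} [AddCommGroup M] {N₁ N₂ : Submodule ℤ M} (h : N₁ ≤ N₂)
    (hfree : Module.Free ℤ N₂) : Module.Free ℤ N₁ := by
  have := free_submodule_int (N₁.submoduleOf N₂)
  exact Module.Free.of_equiv (Submodule.submoduleOfEquivOfLe h)

theorem exists_bound {X ι : Type*} [LinearOrder ι] (Z₀ : Set X) (g : ι → X) (s : Set ι)
    (hs : s.Nonempty) (V : Finset X) (hV : ↑V ⊆ Z₀ ∪ g '' s) :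
    ∃ j ∈ s, ↑V ⊆ Z₀ ∪ g '' Set.Iic j := by
  classical
  induction V using Finset.induction_on with
  | empty => exact ⟨hs.some, hs.some_mem, by simp⟩
  | insert a V _ ih =>
    rw [Finset.coe_insert, Set.insert_subset_iff] at hV
    obtain ⟨j, hj, hjV⟩ := ih hV.2
    rcases hV.1 with h | ⟨k, hk, rfl⟩
    · refine ⟨j, hj, ?_⟩
      rw [Finset.coe_insert, Set.insert_subset_iff]
      exact ⟨Or.inl h, hjV⟩
    · refine ⟨max j k, ?_, ?_⟩
      · rcases max_choice j k with h | h <;> rw [h] <;> assumption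
      · rw [Finset.coe_insert, Set.insert_subset_iff]
        refine ⟨Or.inr ⟨k, le_max_right _ _, rfl⟩, hjV.trans ?_⟩
        exact Set.union_subset_union_right _
          (Set.image_mono (Set.Iic_subset_Iic.mpr (le_max_left _ _)))

theorem Rm_bound {X ι : Type*} [LinearOrder ι] (Z₀ : Set X) (g : ι → X) (s : Set ι)
    (hs : s.Nonempty) {f : FracField X} (hf : f ∈ Rm X (Z₀ ∪ g '' s)) :
    ∃ j ∈ s, f ∈ Rm X (Z₀ ∪ g '' Set.Iic j) := by
  classical
  obtain ⟨p, q, hp, hq, hpr, rfl⟩ := hf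
  rw [MvPolynomial.mem_supported] at hp hq
  obtain ⟨j, hj, hV⟩ := exists_bound Z₀ g s hs (p.vars ∪ q.vars) (by
    rw [Finset.coe_union]; exact Set.union_subset hp hq)
  rw [Finset.coe_union, Set.union_subset_iff] at hV
  exact ⟨j, hj, p, q, MvPolynomial.mem_supported.mpr hV.1, MvPolynomial.mem_supported.mpr hV.2,
    hpr, rfl⟩

theorem exists_index (c : Cardinal.{u}) : ∃ (ι : Type u) (_ : LinearOrder ι)
    (_ : WellFoundedLT ι), Cardinal.mk ι = c ∧ ∀ i : ι, Cardinal.mk (Set.Iio i) < c := by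
  refine ⟨c.ord.ToType, inferInstance, inferInstance, Cardinal.mk_ord_toType c, fun i => ?_⟩
  simpa using Cardinal.mk_Iio_lt i

theorem free_Rm {X : Type u} {Z₀ : Set X} (hZ₀ : Z₀.Countable) (hinf : Z₀.Infinite) :
    ∀ (c : Cardinal.{u}) (Z : Set X), Disjoint Z₀ Z → Cardinal.mk Z = c →
      Module.Free ℤ (Rm X (Z₀ ∪ Z)) := by
  classical
  intro c
  induction c using WellFoundedLT.induction with
  | ind c ih =>
    intro Z hdisj hc
    by_cases hZc : Z.Countable
    · exact free_Rm_countable (hZ₀.union hZc)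
    have hc0 : Cardinal.aleph0 < c := by
      rw [← hc, ← not_le, Cardinal.le_aleph0_iff_set_countable]
      exact hZc
    obtain ⟨ι, _, _, hιc, hIio⟩ := exists_index c
    obtain ⟨e⟩ : Nonempty (ι ≃ Z) := Cardinal.eq.mp (hιc.trans hc.symm)
    let g : ι → X := fun i => (e i : X)
    have hginj : Function.Injective g := Subtype.val_injective.comp e.injective
    have hgZ : ∀ i, g i ∈ Z := fun i => (e i).2
    have hgZ₀ : ∀ i, g i ∉ Z₀ := fun i h => Set.disjoint_left.mp hdisj h (hgZ i)
    have hrange : g '' Set.univ = Z := by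
      ext x
      constructor
      · rintro ⟨i, -, rfl⟩; exact hgZ i
      · intro hx; exact ⟨e.symm ⟨x, hx⟩, trivial, by simp [g]⟩
    have hne : Nonempty ι := by
      rw [← Cardinal.mk_ne_zero_iff, hιc]
      exact (lt_trans Cardinal.aleph0_pos hc0).ne'
    have hIic : ∀ i : ι, Cardinal.mk (Set.Iic i) < c := by
      intro i
      rw [← Set.Iio_insert]
      refine lt_of_le_of_lt (Cardinal.mk_insert_le) ?_
      exact Cardinal.add_lt_of_lt hc0.le (hIio i) (lt_trans Cardinal.one_lt_aleph0 hc0)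
    have hy : ∀ i : ι, ∃ k, i < k := by
      intro i
      by_contra h
      push Not at h
      have h1 : Set.Iic i = Set.univ := Set.eq_univ_of_forall h
      have h2 := hIic i
      rw [h1, Cardinal.mk_univ, hιc] at h2
      exact lt_irrefl _ h2
    choose y hy using hy
    -- the target modules
    have hKfree : ∀ i, Module.Free ℤ (Rm X (Z₀ ∪ insert (g (y i)) (g '' Set.Iic i))) := by
      intro i
      have hlt : Cardinal.mk (insert (g (y i)) (g '' Set.Iic i) : Set X) < c := by
        refine lt_of_le_of_lt (Cardinal.mk_insert_le) ?_
        exact Cardinal.add_lt_of_lt hc0.le (lt_of_le_of_lt Cardinal.mk_image_le (hIic i))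
          (lt_trans Cardinal.one_lt_aleph0 hc0)
      refine ih _ hlt _ ?_ rfl
      refine hdisj.mono_right ?_
      rw [Set.insert_subset_iff]
      refine ⟨hgZ _, ?_⟩
      rintro _ ⟨k, -, rfl⟩
      exact hgZ k
    let F : ι → Submodule ℤ (Rm X (Z₀ ∪ Z)) := fun i =>
      (Rm X (Z₀ ∪ g '' Set.Iic i)).comap (Rm X (Z₀ ∪ Z)).subtype
    let inc : ∀ i, F i →ₗ[ℤ] FracField X := fun i => (Rm X (Z₀ ∪ Z)).subtype ∘ₗ (F i).subtype
    let T : ι → FracField X →ₗ[ℤ] FracField X := fun i =>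
      ((Tm (Equiv.swap (g i) (g (y i)))) : FracField X →+* FracField X).toAddMonoidHom.toIntLinearMap
    let φ : ∀ i, F i →ₗ[ℤ] FracField X := fun i =>
      if (Set.Iio i).Nonempty then inc i - T i ∘ₗ inc i else inc i
    have hIicIio : ∀ i, Z₀ ∪ g '' Set.Iic i = insert (g i) (Z₀ ∪ g '' Set.Iio i) := by
      intro i
      rw [← Set.Iio_insert, Set.image_insert_eq, Set.union_insert]
    have hmonoR : ∀ i j, i ≤ j → Rm X (Z₀ ∪ g '' Set.Iic i) ≤ Rm X (Z₀ ∪ g '' Set.Iic j) := by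
      intro i j hij
      exact Rm_mono (Set.union_subset_union_right _ (Set.image_mono (Set.Iic_subset_Iic.mpr hij)))
    have hiW : ∀ i, g i ∉ Z₀ ∪ g '' Set.Iio i := by
      rintro i (h | ⟨k, hk, h⟩)
      · exact hgZ₀ i h
      · rw [hginj h] at hk; exact lt_irrefl _ hk
    have hyW : ∀ i, g (y i) ∉ Z₀ ∪ g '' Set.Iio i := by
      rintro i (h | ⟨k, hk, h⟩)
      · exact hgZ₀ _ h
      · rw [hginj h] at hk; exact lt_asymm (hy i) hk
    refine free_of_filtration F ?_ ?_ φ ?_ ?_ ?_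
    · intro i j hij x hx
      exact hmonoR i j hij hx
    · rintro ⟨x, hx⟩
      right
      have hx' := hx
      rw [← hrange] at hx'
      obtain ⟨j, -, hj⟩ := Rm_bound Z₀ g Set.univ Set.univ_nonempty hx'
      exact ⟨j, hj⟩
    · intro i
      refine free_of_le ?_ (hKfree i)
      rintro _ ⟨x, rfl⟩
      have hx : ((x : Rm X (Z₀ ∪ Z)) : FracField X) ∈ Rm X (Z₀ ∪ g '' Set.Iic i) := x.2
      have h1 : inc i x ∈ Rm X (Z₀ ∪ insert (g (y i)) (g '' Set.Iic i)) :=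
        Rm_mono (Set.union_subset_union_right _ (Set.subset_insert _ _)) hx
      have h2 : T i (inc i x) ∈ Rm X (Z₀ ∪ insert (g (y i)) (g '' Set.Iic i)) := by
        refine Tm_mem (e := Equiv.swap (g i) (g (y i))) ?_ hx
        intro z hz
        by_cases hz1 : z = g i
        · subst hz1
          rw [Equiv.swap_apply_left]
          exact Or.inr (Set.mem_insert _ _)
        by_cases hz2 : z = g (y i)
        · subst hz2
          rw [Equiv.swap_apply_right]
          exact Or.inr (Or.inr ⟨i, le_refl i, rfl⟩)
        rw [Equiv.swap_apply_of_ne_of_ne hz1 hz2]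
        exact hz.imp id Or.inr
      by_cases hi : (Set.Iio i).Nonempty
      · simp only [φ, if_pos hi]
        exact Submodule.sub_mem _ h1 h2
      · simp only [φ, if_neg hi]
        exact h1
    · intro i x hx
      by_cases hi : (Set.Iio i).Nonempty
      · simp only [φ, if_pos hi] at hx
        right
        have hxi : ((x : Rm X (Z₀ ∪ Z)) : FracField X) ∈ Rm X (Z₀ ∪ g '' Set.Iic i) := x.2
        rw [hIicIio] at hxi
        have h1 : Tm (Equiv.swap (g i) (g (y i))) ((x : Rm X (Z₀ ∪ Z)) : FracField X)
            = ((x : Rm X (Z₀ ∪ Z)) : FracField X) := (sub_eq_zero.mp hx).symm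
        have h2 := Tm_ker (hinf.mono Set.subset_union_left) (hiW i) (hyW i)
          (fun h => (hy i).ne' (hginj h)) hxi h1
        exact Rm_bound Z₀ g _ hi h2
      · simp only [φ, if_neg hi] at hx
        left
        exact Subtype.ext hx
    · intro i j x hji hx
      have hi : (Set.Iio i).Nonempty := ⟨j, hji⟩
      simp only [φ, if_pos hi]
      have hx' : ((x : Rm X (Z₀ ∪ Z)) : FracField X) ∈ Rm X (Z₀ ∪ g '' Set.Iio i) := by
        refine Rm_mono (Set.union_subset_union_right _ (Set.image_mono ?_)) hx
        intro k hk
        exact lt_of_le_of_lt hk hji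
      have h1 : Tm (Equiv.swap (g i) (g (y i))) ((x : Rm X (Z₀ ∪ Z)) : FracField X)
            = ((x : Rm X (Z₀ ∪ Z)) : FracField X) := by
        refine Tm_fix ?_ hx'
        intro z hz
        apply Equiv.swap_apply_of_ne_of_ne
        · rintro rfl; exact hiW i hz
        · rintro rfl; exact hyW i hz
      exact sub_eq_zero.mpr h1.symm

theorem free_Rm_univ (X : Type u) [Infinite X] : Module.Free ℤ (Rm X Set.univ) := by
  let Z₀ : Set X := Set.range (Infinite.natEmbedding X)
  have h := free_Rm (Set.countable_range _ : Z₀.Countable)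
    (Set.infinite_range_of_injective (Infinite.natEmbedding X).injective) _ Z₀ᶜ
    disjoint_compl_right rfl
  rwa [Set.union_compl_self] at h

theorem noeth_Rr (X : Type u) : IsNoetherianRing (Rr X Set.univ) := by
  rw [isNoetherianRing_iff_ideal_fg]
  intro I
  have hI : I = (I.comap (Int.castRingHom (Rr X Set.univ))).map (Int.castRingHom _) := by
    apply le_antisymm
    · intro x hx
      obtain ⟨p, q, hp, hq, hpr, hx'⟩ := x.2
      obtain ⟨c, p', hp', rfl⟩ := exists_content p
      have hq0 := prim_alg_ne_zero hpr
      have hp0 := prim_alg_ne_zero hp'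
      have hmem : ∀ p : MvPolynomial X ℤ, p ∈ MvPolynomial.supported ℤ (Set.univ : Set X) := by
        intro p
        rw [MvPolynomial.mem_supported]; exact Set.subset_univ _
      let u : Rr X Set.univ := ⟨_, p', q, hmem _, hmem _, hpr, rfl⟩
      let v : Rr X Set.univ := ⟨_, q, p', hmem _, hmem _, hp', rfl⟩
      have hc : algebraMap (MvPolynomial X ℤ) (FracField X) (MvPolynomial.C c) = (c : FracField X) := by
        simp
      have e1 : x = (c : Rr X Set.univ) * u := by
        apply Subtype.ext
        rw [hx', map_mul, hc, mul_div_assoc]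
        simp [u]
      have e2 : (c : Rr X Set.univ) = v * x := by
        apply Subtype.ext
        rw [Subring.coe_mul, hx', map_mul, hc]
        simp only [v, Subring.coe_intCast]
        field_simp
      have h3 : (c : Rr X Set.univ) ∈ I := by
        rw [e2]; exact I.mul_mem_left _ hx
      rw [e1]
      apply Ideal.mul_mem_right
      exact Ideal.mem_map_of_mem (Int.castRingHom (Rr X Set.univ)) (x := c) (by simpa using h3)
    · exact Ideal.map_comap_le
  rw [hI]
  exact Ideal.FG.map (IsNoetherian.noetherian _) _

theorem card_Rr (X : Type u) [Infinite X] : Cardinal.mk (Rr X Set.univ) = Cardinal.mk X := by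
  apply le_antisymm
  · refine (Cardinal.mk_subtype_le _).trans ?_
    rw [Cardinal.mk_fractionRing, MvPolynomial.cardinalMk_eq_max_lift]
    simp
  · refine Cardinal.mk_le_of_injective (f := fun x : X => (⟨algebraMap (MvPolynomial X ℤ)
      (FracField X) (MvPolynomial.X x), MvPolynomial.X x, 1, ?_, one_mem _, prim_one,
      by simp⟩ : Rr X Set.univ)) ?_
    · rw [MvPolynomial.mem_supported]; exact Set.subset_univ _
    · intro a b hab
      have := congrArg Subtype.val hab
      exact MvPolynomial.X_injective
        (IsFractionRing.injective (MvPolynomial X ℤ) (FracField X) this)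

theorem Rr_all (X : Type u) [Infinite X] :
      IsDomain (Rr X Set.univ) ∧ IsNoetherianRing (Rr X Set.univ) ∧
      Cardinal.mk (Rr X Set.univ) = Cardinal.mk X ∧
      Module.Free ℤ (Rr X Set.univ) := by
  refine ⟨inferInstance, noeth_Rr X, card_Rr X, ?_⟩
  have := free_Rm_univ X
  let e : Rm X Set.univ ≃+ Rr X Set.univ := AddEquiv.refl _
  exact Module.Free.of_equiv e.toIntLinearEquiv

end Main

/-- For every infinite set `X`, the ring `R_X` is a Noetherian integral
domain of cardinality `|X|` whose additive group is free abelian; consequently, for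
every infinite cardinal `κ` there is a Noetherian domain of cardinality `κ` with
free additive group. -/
theorem Rsub_noetherian_domain_free_and_conclusion :
    (∀ (X : Type u) [Infinite X],
      IsDomain (Rsub X Set.univ) ∧ IsNoetherianRing (Rsub X Set.univ) ∧
      Cardinal.mk (Rsub X Set.univ) = Cardinal.mk X ∧
      Module.Free ℤ (Rsub X Set.univ)) ∧
    (∀ κ : Cardinal.{u}, Cardinal.aleph0 ≤ κ →
      ∃ (R : Type u) (_ : CommRing R), IsDomain R ∧ IsNoetherianRing R ∧
        Module.Free ℤ R ∧ Cardinal.mk R = κ) := by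
  have h1 : ∀ (X : Type u) [Infinite X],
      IsDomain (Rsub X Set.univ) ∧ IsNoetherianRing (Rsub X Set.univ) ∧
      Cardinal.mk (Rsub X Set.univ) = Cardinal.mk X ∧
      Module.Free ℤ (Rsub X Set.univ) := by
    intro X _
    rw [Rsub_eq]
    exact Rr_all X
  refine ⟨h1, ?_⟩
  intro κ hκ
  have : Infinite κ.out := by
    rw [Cardinal.infinite_iff, Cardinal.mk_out]; exact hκ
  obtain ⟨ha, hb, hc, hd⟩ := h1 κ.out
  exact ⟨Rsub κ.out Set.univ, inferInstance, ha, hb, hd, by rw [hc, Cardinal.mk_out]⟩
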